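/- The diagonal boundary Boltzmann weights satisfy the boundary (reflection) Yang–Baxter equation: for all u, v ∈ ℝ and all heights a, b, c, d, e ∈ P for which every theta-function denominator appearing is nonzero, ∑_{f,g ∈ P} W(c,f;b,a|u−v) · W(c,d;f,g|u+v) · K(f;g,a|u) · K(d;e,g|v) = ∑_{f,g ∈ P} W(c,d;f,e|u−v) · W(c,f;b,g|u+v) · K(f;e,g|u) · K(b;g,a|v), where K(b;k,k'|u) denotes the boundary weight with left height b and top height k and bottom height k', which vanishes unless k'=k and b=k+ε̄_μ for some μ, in which case K(k+ε̄_μ;k,k|u) = [c−u][k_{1,μ}+c+u] / ([c+u][k_{1,μ}+c−u]) for a fixed real parameter c. (Both sides are invariant under multiplying K by any overall scalar function of u alone, so this normalization of K is equivalent to the paper's, which carries an extra state-independent scalar prefactor.) -/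

import Mathlib

noncomputable section

open scoped BigOperators

attribute [local instance] Classical.propDecidable

namespace ABF

/-- The ambient space `ℝ³`. -/
abbrev V : Type := Fin 3 → ℝ

/-- The standard inner product on `ℝ³`. -/
def ip (v w : V) : ℝ := ∑ i, v i * w i

/-- The orthonormal basis `ε_μ`. -/
def eps (μ : Fin 3) : V := fun ν => if ν = μ then 1 else 0

/-- `ε̄_μ = ε_μ − (ε₁+ε₂+ε₃)/3`. -/
def epsbar (μ : Fin 3) : V := eps μ - (1 / 3 : ℝ) • (eps 0 + eps 1 + eps 2)

/-- The `sl₃` weight lattice `P = ∑ ℤ ε̄_μ`. -/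
def P : AddSubgroup V := AddSubgroup.closure (Set.range epsbar)

/-- `ρ = 2ε̄₁ + ε̄₂`. -/
def rho : V := (2 : ℝ) • epsbar 0 + epsbar 1

/-- `a_μ = (a+ρ | ε̄_μ)`. -/
def ht (a : V) (μ : Fin 3) : ℝ := ip (a + rho) (epsbar μ)

/-- `a_{μ,ν} = a_μ − a_ν`. -/
def htd (a : V) (μ ν : Fin 3) : ℝ := ht a μ - ht a ν

/-- The infinite product `(z;q)_∞`. -/
def poch (z q : ℝ) : ℝ := ∏' j : ℕ, (1 - q ^ j * z)

/-- The double infinite product `(z;q₁,q₂)_∞`. -/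
def poch2 (z q₁ q₂ : ℝ) : ℝ := ∏' p : ℕ × ℕ, (1 - q₁ ^ p.1 * q₂ ^ p.2 * z)

/-- The theta function `Θ_q(z) = (q;q)_∞ (z;q)_∞ (q/z;q)_∞`. -/
def theta (q z : ℝ) : ℝ := poch q q * poch z q * poch (q / z) q

/-- The elliptic theta function `[u] = x^{u²/r−u} Θ_{x^{2r}}(x^{2u})`. -/
def bra (x r u : ℝ) : ℝ := x ^ (u ^ 2 / r - u) * theta (x ^ (2 * r)) (x ^ (2 * u))

/-- `h₁(z)`. -/
def h1fun (x r z : ℝ) : ℝ :=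
  poch2 (x ^ (2 : ℝ) * z) (x ^ (2 * r)) (x ^ (6 : ℝ)) *
      poch2 (x ^ (2 * r + 4) * z) (x ^ (2 * r)) (x ^ (6 : ℝ)) /
    (poch2 (x ^ (2 * r) * z) (x ^ (2 * r)) (x ^ (6 : ℝ)) *
      poch2 (x ^ (6 : ℝ) * z) (x ^ (2 * r)) (x ^ (6 : ℝ)))

/-- `r₁(u) = z^{2(r−1)/(3r)} h₁(z⁻¹)/h₁(z)`, `z = x^{2u}`. -/
def r1 (x r u : ℝ) : ℝ :=
  (x ^ (2 * u)) ^ (2 * (r - 1) / (3 * r)) * h1fun x r (x ^ (2 * u))⁻¹ / h1fun x r (x ^ (2 * u))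

/-- `idx v = some μ` if `v = ε̄_μ`, and `none` otherwise. -/
def idx (v : V) : Option (Fin 3) :=
  if h : ∃ μ : Fin 3, v = epsbar μ then some h.choose else none

/-- The bulk Boltzmann weight `W(a,b;c,d|u)` (top `a`, upper-right `b`, lower-left `c`,
bottom `d`):  it is `r₁(u)` on configurations `(d+2ε̄_μ, d+ε̄_μ; d+ε̄_μ, d)`,
`r₁(u)·[u][d_{μν}−1]/([u−1][d_{μν}])` on `(d+ε̄_μ+ε̄_ν, d+ε̄_μ; d+ε̄_ν, d)` with `μ ≠ ν`,
`r₁(u)·[u−d_{μν}][1]/([u−1][d_{μν}])` on `(d+ε̄_μ+ε̄_ν, d+ε̄_ν; d+ε̄_ν, d)` with `μ ≠ ν`,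
and `0` otherwise. -/
def W (x r : ℝ) (a b c d : V) (u : ℝ) : ℝ :=
  match idx (b - d), idx (a - b), idx (c - d), idx (a - c) with
  | some p, some q, some p', some q' =>
      if q = p ∧ p' = p ∧ q' = p then r1 x r u
      else if p ≠ q ∧ p' = q ∧ q' = p then
        r1 x r u * (bra x r u * bra x r (htd d p q - 1)) /
          (bra x r (u - 1) * bra x r (htd d p q))
      else if p ≠ q ∧ p' = p ∧ q' = q then
        r1 x r u * (bra x r (u - htd d q p) * bra x r 1) /
          (bra x r (u - 1) * bra x r (htd d q p))
      else 0
  | _, _, _, _ => 0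


/-- The diagonal boundary Boltzmann weight `K(b; k, k'|u)` (left height `b`, top height `k`,
bottom height `k'`): it vanishes unless `k' = k` and `b = k + ε̄_μ` for some `μ`, in which
case it equals `[c₀−u][k_{1,μ}+c₀+u] / ([c₀+u][k_{1,μ}+c₀−u])`. -/
def K (x r c₀ : ℝ) (b k k' : V) (u : ℝ) : ℝ :=
  if k' = k then
    match idx (b - k) with
    | some μ =>
        bra x r (c₀ - u) * bra x r (htd k 0 μ + c₀ + u) /
          (bra x r (c₀ + u) * bra x r (htd k 0 μ + c₀ - u))
    | none => 0
  else 0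

open Filter Topology

/-! ### The Jacobi triple product -/

/-- finite product `(q;q)_n`. -/
def pf (q : ℝ) (n : ℕ) : ℝ := ∏ i ∈ Finset.range n, (1 - q ^ i * q)

/-- `1/(q;q)_n`, extended by zero to negative `n`. -/
def ipf (q : ℝ) (n : ℤ) : ℝ := if 0 ≤ n then (pf q n.toNat)⁻¹ else 0

lemma pf_pos {q : ℝ} (h0 : 0 < q) (h1 : q < 1) (n : ℕ) : 0 < pf q n := by
  unfold pf
  refine Finset.prod_pos fun i _ => ?_
  have := pow_lt_one₀ h0.le h1 (Nat.succ_ne_zero i)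
  rw [pow_succ] at this
  linarith

lemma pf_le_one {q : ℝ} (h0 : 0 < q) (h1 : q < 1) (n : ℕ) : pf q n ≤ 1 := by
  unfold pf
  refine Finset.prod_le_one (fun i _ => ?_) (fun i _ => ?_)
  · have := pow_lt_one₀ h0.le h1 (Nat.succ_ne_zero i)
    rw [pow_succ] at this
    linarith
  · have : 0 < q ^ i * q := by positivity
    linarith

lemma pf_succ (q : ℝ) (n : ℕ) : pf q (n + 1) = pf q n * (1 - q ^ n * q) :=
  Finset.prod_range_succ _ _

lemma ipf_rec {q : ℝ} (h0 : 0 < q) (h1 : q < 1) (n : ℤ) :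
    ipf q (n - 1) = (1 - q ^ n) * ipf q n := by
  unfold ipf
  rcases lt_trichotomy n 0 with h | h | h
  · rw [if_neg (by omega), if_neg (by omega)]; simp
  · subst h; simp
  · obtain ⟨m, rfl⟩ : ∃ m : ℕ, n = m + 1 := ⟨(n - 1).toNat, by omega⟩
    rw [if_pos (by omega), if_pos (by omega)]
    have e1 : ((m : ℤ) + 1 - 1).toNat = m := by omega
    have e2 : ((m : ℤ) + 1).toNat = m + 1 := by omega
    rw [e1, e2, pf_succ]
    have hm := pf_pos h0 h1 m
    have hm' := pf_pos h0 h1 (m + 1)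
    rw [pf_succ] at hm'
    have h3 : (1 - q ^ m * q) ≠ 0 := fun h => by rw [h] at hm'; simp at hm'
    rw [zpow_add₀ h0.ne', zpow_natCast, zpow_one, mul_inv]
    field_simp

lemma ipf_nonneg {q : ℝ} (h0 : 0 < q) (h1 : q < 1) (n : ℤ) : 0 ≤ ipf q n := by
  unfold ipf
  split_ifs
  · exact (inv_pos.2 (pf_pos h0 h1 _)).le
  · exact le_rfl

lemma summable_geo {q : ℝ} (h0 : 0 < q) (h1 : q < 1) (z : ℝ) :
    Summable fun j : ℕ => ‖-(q ^ j * z)‖ := by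
  simp only [norm_neg, norm_mul, norm_pow]
  refine Summable.mul_right _ (summable_geometric_of_lt_one (norm_nonneg _) ?_)
  rwa [Real.norm_of_nonneg h0.le]

lemma tendsto_poch {q : ℝ} (h0 : 0 < q) (h1 : q < 1) (z : ℝ) :
    Tendsto (fun n => ∏ i ∈ Finset.range n, (1 - q ^ i * z)) atTop (𝓝 (poch z q)) := by
  have := (multipliable_one_add_of_summable (summable_geo h0 h1 z)).tendsto_prod_tprod_nat
  simp only [← sub_eq_add_neg] at this
  exact this

lemma poch_qq_ne {q : ℝ} (h0 : 0 < q) (h1 : q < 1) : poch q q ≠ 0 := by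
  have := tprod_one_add_ne_zero_of_summable (f := fun j : ℕ => -(q ^ j * q)) (fun i => ?_)
    (summable_geo h0 h1 q)
  · simp only [← sub_eq_add_neg] at this
    exact this
  · have := pow_lt_one₀ h0.le h1 (Nat.succ_ne_zero i)
    rw [pow_succ] at this
    have h : 0 < 1 + -(q ^ i * q) := by linarith
    exact h.ne'

lemma tendsto_pf {q : ℝ} (h0 : 0 < q) (h1 : q < 1) :
    Tendsto (pf q) atTop (𝓝 (poch q q)) := tendsto_poch h0 h1 q

lemma ipf_bound {q : ℝ} (h0 : 0 < q) (h1 : q < 1) : ∃ C, ∀ n, ipf q n ≤ C := by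
  obtain ⟨C, hC⟩ := ((tendsto_pf h0 h1).inv₀ (poch_qq_ne h0 h1)).bddAbove_range
  refine ⟨max C 0, fun n => ?_⟩
  unfold ipf
  split_ifs
  · exact le_trans (hC ⟨_, rfl⟩) (le_max_left _ _)
  · exact le_max_right _ _

lemma tendsto_ipf {q : ℝ} (h0 : 0 < q) (h1 : q < 1) (k : ℤ) :
    Tendsto (fun N : ℕ => ipf q (N + k)) atTop (𝓝 (poch q q)⁻¹) := by
  have h : Tendsto (fun N : ℕ => ((N : ℤ) + k).toNat) atTop atTop := by
    refine tendsto_atTop.2 fun b => ?_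
    filter_upwards [eventually_ge_atTop (b + k.natAbs)] with N hN
    omega
  refine (((tendsto_pf h0 h1).inv₀ (poch_qq_ne h0 h1)).comp h).congr' ?_
  filter_upwards [eventually_ge_atTop (k.natAbs)] with N hN
  simp only [Function.comp, ipf]
  rw [if_pos (by omega)]

/-- Coefficients of the finite triple product. -/
def cf (q : ℝ) (N : ℕ) (k : ℤ) : ℝ := pf q (2 * N) * ipf q (N + k) * ipf q (N - k)

lemma cf_rec {q : ℝ} (h0 : 0 < q) (h1 : q < 1) (N : ℕ) (k : ℤ) :
    cf q (N + 1) k = cf q N k * (1 + q ^ (2 * N + 1)) + q ^ ((N : ℤ) + 1 - k) * cf q N (k - 1)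
      + q ^ ((N : ℤ) + 1 + k) * cf q N (k + 1) := by
  unfold cf
  have a1 := ipf_rec h0 h1 (N + 1 + k)
  have a2 := ipf_rec h0 h1 (N + 1 - k)
  have a3 := ipf_rec h0 h1 (N + k)
  have a4 := ipf_rec h0 h1 (N - k)
  have e1 : (N : ℤ) + 1 + k - 1 = N + k := by ring
  have e2 : (N : ℤ) + 1 - k - 1 = N - k := by ring
  rw [e1] at a1
  rw [e2] at a2
  have e3 : (N : ℤ) + (k - 1) = N + k - 1 := by ring
  have e4 : (N : ℤ) - (k - 1) = N + 1 - k := by ring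
  have e5 : (N : ℤ) + (k + 1) = N + 1 + k := by ring
  have e6 : (N : ℤ) - (k + 1) = N - k - 1 := by ring
  have e7 : 2 * (N + 1) = 2 * N + 1 + 1 := by ring
  rw [e3, e4, e5, e6, a3, a4, a1, a2, e7, pf_succ, pf_succ]
  push_cast
  have hq := h0.ne'
  have hk : q ^ k ≠ 0 := zpow_ne_zero _ hq
  simp only [zpow_add₀ hq, zpow_sub₀ hq, zpow_natCast, zpow_one]
  field_simp
  ring

lemma finite_triple {q z : ℝ} (h0 : 0 < q) (h1 : q < 1) (hz : z ≠ 0) (T : ℤ → ℝ) (T0 : T 0 = 1)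
    (Tr : ∀ k, T (k + 1) = -(q ^ k * z) * T k) (N : ℕ) :
    HasSum (fun k => T k * cf q N k)
      ((∏ i ∈ Finset.range N, (1 - q ^ i * z)) * ∏ i ∈ Finset.range N, (1 - q ^ i * (q / z))) := by
  induction N with
  | zero =>
    have : (fun k => T k * cf q 0 k) = fun k => if k = 0 then 1 else 0 := by
      funext k
      split_ifs with h
      · subst h; simp [T0, cf, pf, ipf]
      · rcases lt_or_gt_of_ne h with h | h
        · simp [cf, ipf, h.not_ge]
        · simp [cf, ipf, h.not_ge]
    rw [this]
    simpa using hasSum_ite_eq (0 : ℤ) (1 : ℝ)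
  | succ N ih =>
    have s1 := ((Equiv.subRight (1 : ℤ)).hasSum_iff).2 ih
    have s2 := ((Equiv.addRight (1 : ℤ)).hasSum_iff).2 ih
    have := ((ih.mul_left (1 + q ^ (2 * N + 1))).add (s1.mul_left (-(q ^ N * z)))).add
      (s2.mul_left (-(q ^ (N + 1) / z)))
    have hf : (fun k => T k * cf q (N + 1) k) = fun k =>
        (1 + q ^ (2 * N + 1)) * (T k * cf q N k) + -(q ^ N * z) * (T (k - 1) * cf q N (k - 1)) +
        -(q ^ (N + 1) / z) * (T (k + 1) * cf q N (k + 1)) := by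
      funext k
      rw [cf_rec h0 h1, Tr k]
      have hT : T k = -(q ^ (k - 1) * z) * T (k - 1) := by
        have := Tr (k - 1)
        rwa [sub_add_cancel] at this
      rw [hT]
      have hq := h0.ne'
      have hk : q ^ k ≠ 0 := zpow_ne_zero _ hq
      simp only [zpow_add₀ hq, zpow_sub₀ hq, zpow_natCast, zpow_one]
      field_simp
      ring
    have hv : (∏ i ∈ Finset.range (N + 1), (1 - q ^ i * z)) *
        ∏ i ∈ Finset.range (N + 1), (1 - q ^ i * (q / z)) = (1 + q ^ (2 * N + 1)) * ((∏ i ∈ Finset.range N, (1 - q ^ i * z)) *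
            ∏ i ∈ Finset.range N, (1 - q ^ i * (q / z))) +
            -(q ^ N * z) * ((∏ i ∈ Finset.range N, (1 - q ^ i * z)) *
            ∏ i ∈ Finset.range N, (1 - q ^ i * (q / z))) +
            -(q ^ (N + 1) / z) * ((∏ i ∈ Finset.range N, (1 - q ^ i * z)) *
            ∏ i ∈ Finset.range N, (1 - q ^ i * (q / z))) := by
      rw [Finset.prod_range_succ, Finset.prod_range_succ]
      generalize (∏ i ∈ Finset.range N, (1 - q ^ i * z)) = A
      generalize (∏ i ∈ Finset.range N, (1 - q ^ i * (q / z))) = B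
      field_simp
      ring
    rw [hf, hv]
    exact this

lemma triple_product {q z : ℝ} (h0 : 0 < q) (h1 : q < 1) (hz : z ≠ 0) (T : ℤ → ℝ) (T0 : T 0 = 1)
    (Tr : ∀ k, T (k + 1) = -(q ^ k * z) * T k) (hT : Summable fun k => |T k|) :
    theta q z = ∑' k, T k := by
  obtain ⟨C, hC⟩ := ipf_bound h0 h1
  have hC0 : 0 ≤ C := (ipf_nonneg h0 h1 0).trans (hC 0)
  have hne := poch_qq_ne h0 h1
  have lim : Tendsto (fun N : ℕ => ∑' k, T k * cf q N k) atTop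
      (𝓝 (∑' k, T k * (poch q q)⁻¹)) := by
    refine tendsto_tsum_of_dominated_convergence (bound := fun k => |T k| * (C * C))
      (hT.mul_right _) (fun k => ?_) (Eventually.of_forall fun N k => ?_)
    · refine Tendsto.const_mul _ ?_
      have l0 : Tendsto (fun N : ℕ => pf q (2 * N)) atTop (𝓝 (poch q q)) :=
        (tendsto_pf h0 h1).comp (tendsto_id.const_mul_atTop' (by norm_num))
      have := (l0.mul (tendsto_ipf h0 h1 k)).mul (tendsto_ipf h0 h1 (-k))
      rw [mul_inv_cancel₀ hne, one_mul] at this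
      simp only [← sub_eq_add_neg] at this
      exact this
    · rw [norm_mul, Real.norm_eq_abs]
      refine mul_le_mul_of_nonneg_left ?_ (abs_nonneg _)
      unfold cf
      have p0 := ipf_nonneg h0 h1 (N + k)
      have p1 := ipf_nonneg h0 h1 (N - k)
      have p2 := (pf_pos h0 h1 (2 * N)).le
      rw [Real.norm_of_nonneg (by positivity)]
      refine mul_le_mul ?_ (hC _) p1 hC0
      calc _ ≤ 1 * ipf q (N + k) := mul_le_mul_of_nonneg_right (pf_le_one h0 h1 _) p0
        _ ≤ C := by rw [one_mul]; exact hC _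
  have lim2 := (tendsto_poch h0 h1 z).mul (tendsto_poch h0 h1 (q / z))
  have := tendsto_nhds_unique lim2 (lim.congr fun N => (finite_triple h0 h1 hz T T0 Tr N).tsum_eq)
  rw [tsum_mul_right] at this
  unfold theta
  rw [mul_assoc, this]
  field_simp

/-! ### Gaussian series for the bracket -/

lemma summable_gauss {x : ℝ} (hx0 : 0 < x) (hx1 : x < 1) {A : ℝ} (hA : 0 < A) (B D : ℝ) :
    Summable fun k : ℤ => x ^ (A * (k : ℝ) ^ 2 + B * k + D) := by
  have hl : 0 < -Real.log x := by have := Real.log_neg hx0 hx1; linarith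
  have hpi := Real.pi_pos
  have h := summable_pow_mul_jacobiTheta₂_term_bound
    (-Real.log x * |B| / (2 * Real.pi)) (T := -Real.log x * A / Real.pi) (by positivity) 0
  refine (Summable.mul_left (x ^ D) h).of_nonneg_of_le (fun k => by positivity) fun k => ?_
  rw [Real.rpow_add hx0, mul_comm (x ^ D), pow_zero, one_mul]
  refine mul_le_mul_of_nonneg_right ?_ (by positivity)
  rw [Real.rpow_def_of_pos hx0, Real.exp_le_exp]
  have e : -Real.pi * (-Real.log x * A / Real.pi * (k : ℝ) ^ 2
      - 2 * (-Real.log x * |B| / (2 * Real.pi)) * |(k : ℝ)|)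
      = Real.log x * (A * (k : ℝ) ^ 2) + (-Real.log x) * (|B| * |(k : ℝ)|) := by
    field_simp
    ring
  push_cast at e ⊢
  rw [e]
  have : -(B * k) ≤ |B| * |(k : ℝ)| := by rw [← abs_mul]; exact neg_le_abs _
  nlinarith [mul_le_mul_of_nonneg_left this hl.le]

lemma neg_one_zpow_abs (k : ℤ) : |((-1 : ℝ)) ^ k| = 1 := by
  rw [abs_zpow]; simp

/-- term of the Gaussian series. -/
def gt (x r u : ℝ) (k : ℤ) : ℝ := (-1) ^ k * x ^ ((u + r * (k - 1 / 2)) ^ 2 / r)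

lemma summable_gt {x r : ℝ} (hx0 : 0 < x) (hx1 : x < 1) (hr : 0 < r) (u : ℝ) :
    Summable fun k => |gt x r u k| := by
  refine (summable_gauss hx0 hx1 hr (2 * u - r) (u ^ 2 / r - u + r / 4)).congr fun k => ?_
  unfold gt
  rw [abs_mul, neg_one_zpow_abs, one_mul, abs_of_pos (by positivity)]
  congr 1
  field_simp
  ring

lemma bra_series {x r : ℝ} (hx0 : 0 < x) (hx1 : x < 1) (hr : 0 < r) (u : ℝ) :
    bra x r u = x ^ (-(r / 4)) * ∑' k, gt x r u k := by
  have key : theta (x ^ (2 * r)) (x ^ (2 * u)) =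
      ∑' k : ℤ, x ^ (-(u ^ 2 / r - u) - r / 4) * gt x r u k := by
    refine triple_product (by positivity) (Real.rpow_lt_one hx0.le hx1 (by positivity))
      (by positivity) _ ?_ (fun k => ?_) ?_
    · simp only [gt, zpow_zero, one_mul]
      rw [← Real.rpow_add hx0]
      convert Real.rpow_zero x using 2
      push_cast
      field_simp
      ring
    · simp only [gt]
      rw [← Real.rpow_intCast (x ^ (2 * r)) k, ← Real.rpow_mul hx0.le, zpow_add₀ (by norm_num : (-1 : ℝ) ≠ 0)]
      have : x ^ (-(u ^ 2 / r - u) - r / 4) * x ^ ((u + r * ((k + 1 : ℤ) - 1 / 2)) ^ 2 / r)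
        = x ^ (2 * r * k) * x ^ (2 * u) *
          (x ^ (-(u ^ 2 / r - u) - r / 4) * x ^ ((u + r * (k - 1 / 2)) ^ 2 / r)) := by
        simp only [← Real.rpow_add hx0]
        congr 1
        push_cast
        field_simp
        ring
      linear_combination (-(-1) ^ k) * this
    · simp only [abs_mul]
      exact (summable_gt hx0 hx1 hr u).mul_left _
  unfold bra
  rw [key, tsum_mul_left, ← mul_assoc, ← Real.rpow_add hx0]
  congr 2
  ring

lemma bra_neg {x r : ℝ} (hx0 : 0 < x) (hx1 : x < 1) (hr : 0 < r) (u : ℝ) :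
    bra x r (-u) = -bra x r u := by
  rw [bra_series hx0 hx1 hr, bra_series hx0 hx1 hr, ← mul_neg, ← tsum_neg]
  congr 1
  rw [← (Equiv.subLeft (1 : ℤ)).tsum_eq]
  congr 1
  funext k
  simp only [Equiv.subLeft_apply, gt]
  rw [zpow_sub₀ (by norm_num : (-1 : ℝ) ≠ 0), zpow_one]
  have : (-u + r * ((1 - k : ℤ) - 1 / 2)) ^ 2 = (u + r * (k - 1 / 2)) ^ 2 := by push_cast; ring
  rw [this]
  have h2 : ((-1 : ℝ) ^ k) * (-1) ^ k = 1 := by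
    rw [← mul_zpow]; simp
  have h3 : (-1 : ℝ) / (-1) ^ k = -(-1) ^ k := by
    rw [div_eq_iff (zpow_ne_zero _ (by norm_num))]; linarith
  rw [h3]; ring

/-- The two second-order theta series. -/
def F0 (x r u : ℝ) : ℝ := ∑' m : ℤ, x ^ (2 * (u + r * m) ^ 2 / r)
/-- The two second-order theta series. -/
def F1 (x r u : ℝ) : ℝ := ∑' m : ℤ, x ^ (2 * (u + r * m + r / 2) ^ 2 / r)

/-- Parity decomposition of `ℤ × ℤ`. -/
def parFun : (ℤ × ℤ) ⊕ (ℤ × ℤ) → ℤ × ℤ :=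
  Sum.elim (fun p => (p.1 + p.2 + 1, p.1 - p.2 + 1)) (fun p => (p.1 + p.2 + 1, p.1 - p.2))

lemma parFun_bij : Function.Bijective parFun := by
  constructor
  · rintro (⟨a, b⟩ | ⟨a, b⟩) (⟨c, d⟩ | ⟨c, d⟩) h <;>
      simp only [parFun, Sum.elim_inl, Sum.elim_inr, Prod.mk.injEq, Sum.inl.injEq, Sum.inr.injEq,
        reduceCtorEq] at h ⊢ <;> omega
  · rintro ⟨a, b⟩
    rcases Int.emod_two_eq_zero_or_one (a + b) with h | h
    · refine ⟨Sum.inl ((a + b - 2) / 2, (a - b) / 2), ?_⟩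
      simp only [parFun, Sum.elim_inl, Prod.mk.injEq]; omega
    · refine ⟨Sum.inr ((a + b - 1) / 2, (a - b - 1) / 2), ?_⟩
      simp only [parFun, Sum.elim_inr, Prod.mk.injEq]; omega

/-- Parity decomposition of `ℤ × ℤ`. -/
def parEquiv : (ℤ × ℤ) ⊕ (ℤ × ℤ) ≃ ℤ × ℤ := Equiv.ofBijective parFun parFun_bij

lemma parEquiv_inl (p : ℤ × ℤ) : parEquiv (Sum.inl p) = (p.1 + p.2 + 1, p.1 - p.2 + 1) := rfl

lemma parEquiv_inr (p : ℤ × ℤ) : parEquiv (Sum.inr p) = (p.1 + p.2 + 1, p.1 - p.2) := rfl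

set_option maxHeartbeats 2000000 in
lemma bra_mul {x r : ℝ} (hx0 : 0 < x) (hx1 : x < 1) (hr : 0 < r) (u v : ℝ) :
    bra x r (u + v) * bra x r (u - v) =
      (x ^ (-(r / 4))) ^ 2 * (F1 x r u * F0 x r v - F0 x r u * F1 x r v) := by
  have S0 : ∀ w, Summable fun m : ℤ => x ^ (2 * (w + r * m) ^ 2 / r) := fun w => by
    refine (summable_gauss hx0 hx1 (A := 2 * r) (by positivity) (4 * w) (2 * w ^ 2 / r)).congr
      fun k => ?_
    congr 1
    field_simp
    ring
  have S1 : ∀ w, Summable fun m : ℤ => x ^ (2 * (w + r * m + r / 2) ^ 2 / r) := fun w => by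
    refine (summable_gauss hx0 hx1 (A := 2 * r) (by positivity) (4 * w + 2 * r)
      (2 * (w + r / 2) ^ 2 / r)).congr fun k => ?_
    congr 1
    field_simp
    ring
  have hsum : HasSum (fun p : ℤ × ℤ => gt x r (u + v) p.1 * gt x r (u - v) p.2)
      ((∑' k, gt x r (u + v) k) * ∑' k, gt x r (u - v) k) := by
    have a1 := summable_gt hx0 hx1 hr (u + v)
    have a2 := summable_gt hx0 hx1 hr (u - v)
    exact a1.of_abs.hasSum.mul a2.of_abs.hasSum (summable_mul_of_summable_norm a1 a2)
  have p1 : HasSum (fun p : ℤ × ℤ => x ^ (2 * (u + r * p.1 + r / 2) ^ 2 / r) *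
      x ^ (2 * (v + r * p.2) ^ 2 / r)) (F1 x r u * F0 x r v) :=
    (S1 u).hasSum.mul (S0 v).hasSum (summable_mul_of_summable_norm (S1 u).norm (S0 v).norm)
  have p2 : HasSum (fun p : ℤ × ℤ => x ^ (2 * (u + r * p.1) ^ 2 / r) *
      x ^ (2 * (v + r * p.2 + r / 2) ^ 2 / r)) (F0 x r u * F1 x r v) :=
    (S0 u).hasSum.mul (S1 v).hasSum (summable_mul_of_summable_norm (S0 u).norm (S1 v).norm)
  have hall : HasSum ((fun p : ℤ × ℤ => gt x r (u + v) p.1 * gt x r (u - v) p.2) ∘ parEquiv)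
      (F1 x r u * F0 x r v + -(F0 x r u * F1 x r v)) := by
    refine HasSum.sum ?_ ?_
    · convert p1 using 1
      funext p
      simp only [Function.comp, parEquiv_inl, gt]
      have hs : ((-1 : ℝ) ^ (p.1 + p.2 + 1)) * (-1) ^ (p.1 - p.2 + 1) = 1 := by
        rw [← zpow_add₀ (by norm_num)]
        exact Even.neg_one_zpow ⟨p.1 + 1, by ring⟩
      rw [mul_mul_mul_comm, hs, one_mul, ← Real.rpow_add hx0, ← Real.rpow_add hx0]
      congr 1
      push_cast
      field_simp
      ring
    · have p3 : HasSum (fun p : ℤ × ℤ => -(x ^ (2 * (u + r * p.1) ^ 2 / r) *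
          x ^ (2 * (v + r * p.2 + r / 2) ^ 2 / r))) (-(F0 x r u * F1 x r v)) := p2.neg
      convert p3 using 1
      funext p
      simp only [Function.comp, parEquiv_inr, gt]
      have hs : ((-1 : ℝ) ^ (p.1 + p.2 + 1)) * (-1) ^ (p.1 - p.2) = -1 := by
        rw [← zpow_add₀ (by norm_num)]
        exact Odd.neg_one_zpow ⟨p.1, by ring⟩
      rw [mul_mul_mul_comm, hs, neg_one_mul, ← Real.rpow_add hx0, ← Real.rpow_add hx0]
      congr 2
      push_cast
      field_simp
      ring
  have := (parEquiv.hasSum_iff.1 hall).unique hsum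
  rw [bra_series hx0 hx1 hr, bra_series hx0 hx1 hr]
  linear_combination (-(x ^ (-(r / 4))) ^ 2) * this

/-- The six-fold product identity behind the reflection equation. -/
lemma refl_core {x r : ℝ} (hx0 : 0 < x) (hx1 : x < 1) (hr : 0 < r) (u v m n : ℝ) :
    -(bra x r (u - v + n) * bra x r (u + v) * bra x r (m + u) * bra x r (m + n + v) *
        bra x r (m - v) * bra x r (m + n - u))
      + bra x r (u - v) * bra x r (u + v - n) * bra x r (m + n + u) * bra x r (m + n + v) *
        bra x r (m - u) * bra x r (m - v)
      + bra x r (u - v) * bra x r (u + v + n) * bra x r (m + u) * bra x r (m + v) *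
        bra x r (m + n - u) * bra x r (m + n - v)
      - bra x r (u - v - n) * bra x r (u + v) * bra x r (m + n + u) * bra x r (m + v) *
        bra x r (m - u) * bra x r (m + n - v) = 0 := by
  have g1 := bra_mul hx0 hx1 hr (u + n / 2) (v - n / 2)
  have g2 := bra_mul hx0 hx1 hr (u - n / 2) (v - n / 2)
  have g3 := bra_mul hx0 hx1 hr (u + n / 2) (v + n / 2)
  have g4 := bra_mul hx0 hx1 hr (u - n / 2) (v + n / 2)
  have g5 := bra_mul hx0 hx1 hr (m + n / 2) (u + n / 2)
  have g6 := bra_mul hx0 hx1 hr (m + n / 2) (u - n / 2)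
  have g7 := bra_mul hx0 hx1 hr (m + n / 2) (v + n / 2)
  have g8 := bra_mul hx0 hx1 hr (m + n / 2) (v - n / 2)
  rw [show u + n / 2 + (v - n / 2) = u + v by ring,
    show u + n / 2 - (v - n / 2) = u - v + n by ring] at g1
  rw [show u - n / 2 + (v - n / 2) = u + v - n by ring,
    show u - n / 2 - (v - n / 2) = u - v by ring] at g2
  rw [show u + n / 2 + (v + n / 2) = u + v + n by ring,
    show u + n / 2 - (v + n / 2) = u - v by ring] at g3
  rw [show u - n / 2 + (v + n / 2) = u + v by ring,
    show u - n / 2 - (v + n / 2) = u - v - n by ring] at g4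
  rw [show m + n / 2 + (u + n / 2) = m + n + u by ring,
    show m + n / 2 - (u + n / 2) = m - u by ring] at g5
  rw [show m + n / 2 + (u - n / 2) = m + u by ring,
    show m + n / 2 - (u - n / 2) = m + n - u by ring] at g6
  rw [show m + n / 2 + (v + n / 2) = m + n + v by ring,
    show m + n / 2 - (v + n / 2) = m - v by ring] at g7
  rw [show m + n / 2 + (v - n / 2) = m + v by ring,
    show m + n / 2 - (v - n / 2) = m + n - v by ring] at g8
  calc _ = -((bra x r (u + v) * bra x r (u - v + n)) * (bra x r (m + u) * bra x r (m + n - u)) *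
        (bra x r (m + n + v) * bra x r (m - v)))
      + (bra x r (u + v - n) * bra x r (u - v)) * (bra x r (m + n + u) * bra x r (m - u)) *
        (bra x r (m + n + v) * bra x r (m - v))
      + (bra x r (u + v + n) * bra x r (u - v)) * (bra x r (m + u) * bra x r (m + n - u)) *
        (bra x r (m + v) * bra x r (m + n - v))
      - (bra x r (u + v) * bra x r (u - v - n)) * (bra x r (m + n + u) * bra x r (m - u)) *
        (bra x r (m + v) * bra x r (m + n - v)) := by ring
    _ = 0 := by
      rw [g1, g2, g3, g4, g5, g6, g7, g8]
      ring

/-! ### Combinatorics of the heights -/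

lemma epsbar_apply (μ ν : Fin 3) : epsbar μ ν = (if ν = μ then 1 else 0) - 1 / 3 := by
  fin_cases μ <;> fin_cases ν <;> simp [epsbar, eps]

lemma epsbar_inj {μ ν : Fin 3} (h : epsbar μ = epsbar ν) : μ = ν := by
  by_contra hne
  have := congrFun h μ
  rw [epsbar_apply, epsbar_apply, if_pos rfl, if_neg hne] at this
  norm_num at this

lemma idx_eq_some {w : V} {μ : Fin 3} : idx w = some μ ↔ w = epsbar μ := by
  unfold idx
  constructor
  · intro h
    split_ifs at h with h1
    rw [← Option.some.inj h]
    exact h1.choose_spec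
  · intro h
    have h1 : ∃ μ : Fin 3, w = epsbar μ := ⟨μ, h⟩
    rw [dif_pos h1]
    congr 1
    exact epsbar_inj (h1.choose_spec.symm.trans h)

lemma idx_epsbar (μ : Fin 3) : idx (epsbar μ) = some μ := idx_eq_some.2 rfl

lemma idx_eq_none {w : V} : idx w = none ↔ ∀ μ, w ≠ epsbar μ := by
  rw [Option.eq_none_iff_forall_ne_some]
  exact forall_congr' fun μ => not_congr idx_eq_some

lemma pair_eq {p q p' q' : Fin 3} (h : epsbar p + epsbar q = epsbar p' + epsbar q') :
    p' = p ∧ q' = q ∨ p' = q ∧ q' = p := by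
  have h0 := congrFun h 0
  have h1 := congrFun h 1
  have h2 := congrFun h 2
  simp only [Pi.add_apply, epsbar_apply] at h0 h1 h2
  revert h0 h1 h2
  fin_cases p <;> fin_cases q <;> fin_cases p' <;> fin_cases q' <;> simp <;> norm_num

lemma epsbar_mem (μ : Fin 3) : epsbar μ ∈ P := AddSubgroup.subset_closure ⟨μ, rfl⟩

lemma W_zero1 (x r : ℝ) {a b c d : V} (u : ℝ) (h : idx (b - d) = none) : W x r a b c d u = 0 := by
  unfold W; rw [h]
lemma W_zero2 (x r : ℝ) {a b c d : V} (u : ℝ) (h : idx (a - b) = none) : W x r a b c d u = 0 := by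
  unfold W; rw [h]; cases idx (b - d) <;> rfl
lemma W_zero3 (x r : ℝ) {a b c d : V} (u : ℝ) (h : idx (c - d) = none) : W x r a b c d u = 0 := by
  unfold W; rw [h]; cases idx (b - d) <;> cases idx (a - b) <;> rfl
lemma W_zero4 (x r : ℝ) {a b c d : V} (u : ℝ) (h : idx (a - c) = none) : W x r a b c d u = 0 := by
  unfold W; rw [h]; cases idx (b - d) <;> cases idx (a - b) <;> cases idx (c - d) <;> rfl

lemma idx_third {p q f : Fin 3} (h1 : f ≠ p) (h2 : f ≠ q) (a : V) :
    idx (a + epsbar p + epsbar q - (a + epsbar f)) = none := by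
  rw [idx_eq_none]
  intro μ h
  have : epsbar p + epsbar q = epsbar f + epsbar μ := by
    rw [← h]; abel
  rcases pair_eq this with h | h
  · exact h1 h.1
  · exact h2 h.1

lemma W_val (x r : ℝ) (a c : V) (p q p' q' : Fin 3) (u : ℝ) (h : c = a + epsbar p + epsbar q)
    (h' : c = a + epsbar p' + epsbar q') :
    W x r c (a + epsbar p) (a + epsbar p') a u =
      if q = p ∧ p' = p ∧ q' = p then r1 x r u
      else if p ≠ q ∧ p' = q ∧ q' = p then
        r1 x r u * (bra x r u * bra x r (htd a p q - 1)) /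
          (bra x r (u - 1) * bra x r (htd a p q))
      else if p ≠ q ∧ p' = p ∧ q' = q then
        r1 x r u * (bra x r (u - htd a q p) * bra x r 1) /
          (bra x r (u - 1) * bra x r (htd a q p))
      else 0 := by
  have e1 : idx (a + epsbar p - a) = some p := by rw [add_sub_cancel_left, idx_epsbar]
  have e2 : idx (c - (a + epsbar p)) = some q := by rw [h, add_sub_cancel_left, idx_epsbar]
  have e3 : idx (a + epsbar p' - a) = some p' := by rw [add_sub_cancel_left, idx_epsbar]
  have e4 : idx (c - (a + epsbar p')) = some q' := by rw [h', add_sub_cancel_left, idx_epsbar]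
  unfold W
  rw [e1, e2, e3, e4]

lemma K_val (x r c₀ : ℝ) (a : V) (μ : Fin 3) (u : ℝ) :
    K x r c₀ (a + epsbar μ) a a u =
      bra x r (c₀ - u) * bra x r (htd a 0 μ + c₀ + u) /
          (bra x r (c₀ + u) * bra x r (htd a 0 μ + c₀ - u)) := by
  have e1 : idx (a + epsbar μ - a) = some μ := by rw [add_sub_cancel_left, idx_epsbar]
  unfold K
  rw [if_pos rfl, e1]

lemma K_ne (x r c₀ : ℝ) {b k k' : V} (u : ℝ) (h : k' ≠ k) : K x r c₀ b k k' u = 0 := by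
  unfold K; rw [if_neg h]

lemma K_none (x r c₀ : ℝ) {b k : V} (u : ℝ) (h : idx (b - k) = none) : K x r c₀ b k k u = 0 := by
  unfold K; rw [if_pos rfl, h]

lemma finsum_nbr {a : V} (ha : a ∈ P) (H : V → ℝ) (hH : ∀ f, idx (f - a) = none → H f = 0) :
    ∑ᶠ f : P, H f = ∑ μ, H (a + epsbar μ) := by
  let j : Fin 3 → P := fun μ => ⟨a + epsbar μ, P.add_mem ha (epsbar_mem μ)⟩
  have hj : Function.Injective j := fun μ ν h => by
    have := congrArg Subtype.val h
    exact epsbar_inj (add_left_cancel this)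
  rw [finsum_eq_sum_of_support_subset (s := Finset.univ.map ⟨j, hj⟩), Finset.sum_map]
  · rfl
  · intro f hf
    rcases h : idx ((f : V) - a) with _ | μ
    · exact absurd (hH _ h) hf
    · rw [idx_eq_some] at h
      simp only [Finset.coe_map, Function.Embedding.coeFn_mk, Finset.coe_univ, Set.image_univ,
        Set.mem_range]
      refine ⟨μ, Subtype.ext ?_⟩
      simp only [j]
      rw [← h]; abel

/-- The off-diagonal case. -/
lemma offdiag {x r : ℝ} (hx0 : 0 < x) (hx1 : x < 1) (hr : 0 < r) (c₀ u v m n R S : ℝ)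
    (hn : bra x r n ≠ 0)
    (h1 : bra x r (u - v - 1) ≠ 0) (h2 : bra x r (u + v - 1) ≠ 0)
    (h3 : bra x r (c₀ + u) ≠ 0) (h4 : bra x r (c₀ + v) ≠ 0)
    (k1 : bra x r (m - u) ≠ 0) (k2 : bra x r (m - v) ≠ 0)
    (k3 : bra x r (m + n - u) ≠ 0) (k4 : bra x r (m + n - v) ≠ 0) :
    R * (bra x r (u - v - -n) * bra x r 1) / (bra x r (u - v - 1) * bra x r (-n)) *
      (S * (bra x r (u + v) * bra x r (-n - 1)) / (bra x r (u + v - 1) * bra x r (-n))) *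
      (bra x r (c₀ - u) * bra x r (m + u) / (bra x r (c₀ + u) * bra x r (m - u))) *
      (bra x r (c₀ - v) * bra x r (m + n + v) / (bra x r (c₀ + v) * bra x r (m + n - v))) +
    R * (bra x r (u - v) * bra x r (-n - 1)) / (bra x r (u - v - 1) * bra x r (-n)) *
      (S * (bra x r (u + v - n) * bra x r 1) / (bra x r (u + v - 1) * bra x r n)) *
      (bra x r (c₀ - u) * bra x r (m + n + u) / (bra x r (c₀ + u) * bra x r (m + n - u))) *
      (bra x r (c₀ - v) * bra x r (m + n + v) / (bra x r (c₀ + v) * bra x r (m + n - v))) =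
    R * (bra x r (u - v) * bra x r (-n - 1)) / (bra x r (u - v - 1) * bra x r (-n)) *
      (S * (bra x r (u + v - -n) * bra x r 1) / (bra x r (u + v - 1) * bra x r (-n))) *
      (bra x r (c₀ - u) * bra x r (m + u) / (bra x r (c₀ + u) * bra x r (m - u))) *
      (bra x r (c₀ - v) * bra x r (m + v) / (bra x r (c₀ + v) * bra x r (m - v))) +
    R * (bra x r (u - v - n) * bra x r 1) / (bra x r (u - v - 1) * bra x r n) *
      (S * (bra x r (u + v) * bra x r (-n - 1)) / (bra x r (u + v - 1) * bra x r (-n))) *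
      (bra x r (c₀ - u) * bra x r (m + n + u) / (bra x r (c₀ + u) * bra x r (m + n - u))) *
      (bra x r (c₀ - v) * bra x r (m + v) / (bra x r (c₀ + v) * bra x r (m - v))) := by
  have core := refl_core hx0 hx1 hr u v m n
  have e : bra x r (-n - 1) = - bra x r (n + 1) := by
    rw [← bra_neg hx0 hx1 hr]; congr 1; ring
  rw [bra_neg hx0 hx1 hr n, e, sub_neg_eq_add, sub_neg_eq_add]
  generalize bra x r (u - v - 1) = q1 at *
  generalize bra x r (u + v - 1) = q2 at *
  generalize bra x r (c₀ + u) = q3 at *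
  generalize bra x r (c₀ + v) = q4 at *
  generalize bra x r (c₀ - u) = q5 at *
  generalize bra x r (c₀ - v) = q6 at *
  generalize bra x r (m - u) = q7 at *
  generalize bra x r (m - v) = q8 at *
  generalize bra x r (m + n - u) = q9 at *
  generalize bra x r (m + n - v) = q10 at *
  generalize bra x r (m + u) = q11 at *
  generalize bra x r (m + v) = q12 at *
  generalize bra x r (m + n + u) = q13 at *
  generalize bra x r (m + n + v) = q14 at *
  generalize bra x r (u - v + n) = q15 at *
  generalize bra x r (u + v + n) = q16 at *
  generalize bra x r (u - v - n) = q17 at *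
  generalize bra x r (u + v - n) = q18 at *
  generalize bra x r (u - v) = q19 at *
  generalize bra x r (u + v) = q20 at *
  generalize bra x r n = q21 at *
  generalize bra x r (n + 1) = q22 at *
  generalize bra x r 1 = q23 at *
  rw [← sub_eq_zero]
  trans ((R * S * q22 * q23 * q5 * q6) / (q1 * q2 * q3 * q4 * q7 * q8 * q9 * q10 * q21 ^ 2)) *
    (-(q15 * q20 * q11 * q14 * q8 * q9) + q19 * q18 * q13 * q14 * q7 * q8
      + q19 * q16 * q11 * q12 * q9 * q10 - q17 * q20 * q13 * q12 * q7 * q10)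
  · field_simp
    ring
  · rw [core, mul_zero]

/-- **Boundary (reflection) Yang–Baxter equation** for the diagonal boundary weights of the
`U_{q,p}(sl₃)` ABF model. -/
theorem boundary_yang_baxter
    (x : ℝ) (hx0 : 0 < x) (hx1 : x < 1) (r : ℤ) (hr : 5 ≤ r) (c₀ : ℝ)
    (u v : ℝ) (a b c d e : V)
    (ha : a ∈ P) (hb : b ∈ P) (hc : c ∈ P) (hd : d ∈ P) (he : e ∈ P)
    (hden₁ : bra x r (u - v - 1) ≠ 0) (hden₂ : bra x r (u + v - 1) ≠ 0)
    (hdenKu : bra x r (c₀ + u) ≠ 0) (hdenKv : bra x r (c₀ + v) ≠ 0)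
    (hdenW : ∀ g : V, (g = a ∨ g = e) → ∀ μ ν : Fin 3, μ ≠ ν → bra x r (htd g μ ν) ≠ 0)
    (hdenK : ∀ g : V, (g = a ∨ g = e) → ∀ μ : Fin 3,
      bra x r (htd g 0 μ + c₀ - u) ≠ 0 ∧ bra x r (htd g 0 μ + c₀ - v) ≠ 0) :
    ∑ᶠ f : P, ∑ᶠ g : P,
        W x r c (f : V) b a (u - v) * W x r c d (f : V) (g : V) (u + v) *
          K x r c₀ (f : V) (g : V) a u * K x r c₀ d e (g : V) v
      = ∑ᶠ f : P, ∑ᶠ g : P,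
          W x r c d (f : V) e (u - v) * W x r c (f : V) b (g : V) (u + v) *
            K x r c₀ (f : V) e (g : V) u * K x r c₀ b (g : V) a v := by
  have hrpos : (0 : ℝ) < (r : ℝ) := by
    have : 0 < r := by omega
    exact_mod_cast this
  by_cases hea : e = a
  swap
  · have l : ∀ f g : P, W x r c (f : V) b a (u - v) * W x r c d (f : V) (g : V) (u + v) *
          K x r c₀ (f : V) (g : V) a u * K x r c₀ d e (g : V) v = 0 := by
      intro f g
      by_cases h : a = g
      · rw [K_ne x r c₀ (b := d) v (fun h' => hea (h'.symm.trans h.symm)), mul_zero]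
      · rw [K_ne x r c₀ (b := f) u h, mul_zero, zero_mul]
    have l' : ∀ f g : P, W x r c d (f : V) e (u - v) * W x r c (f : V) b (g : V) (u + v) *
            K x r c₀ (f : V) e (g : V) u * K x r c₀ b (g : V) a v = 0 := by
      intro f g
      by_cases h : a = g
      · rw [K_ne x r c₀ (b := f) u (fun h' => hea (h'.symm.trans h.symm)), mul_zero, zero_mul]
      · rw [K_ne x r c₀ (b := b) v h, mul_zero]
    simp only [l, l', finsum_zero]
  subst hea
  -- from here on the bottom height is `e`
  have L : ∀ f : P, ∑ᶠ g : P, W x r c (f : V) b e (u - v) * W x r c d (f : V) (g : V) (u + v) *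
          K x r c₀ (f : V) (g : V) e u * K x r c₀ d e (g : V) v =
        W x r c (f : V) b e (u - v) * W x r c d (f : V) e (u + v) *
          K x r c₀ (f : V) e e u * K x r c₀ d e e v := by
    intro f
    refine finsum_eq_single _ (⟨e, he⟩ : P) fun g hg => ?_
    rw [K_ne x r c₀ (b := d) v (fun h' => hg (Subtype.ext h')), mul_zero]
  have R : ∀ f : P, ∑ᶠ g : P, W x r c d (f : V) e (u - v) * W x r c (f : V) b (g : V) (u + v) *
            K x r c₀ (f : V) e (g : V) u * K x r c₀ b (g : V) e v =
        W x r c d (f : V) e (u - v) * W x r c (f : V) b e (u + v) *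
            K x r c₀ (f : V) e e u * K x r c₀ b e e v := by
    intro f
    refine finsum_eq_single _ (⟨e, he⟩ : P) fun g hg => ?_
    rw [K_ne x r c₀ (b := f) u (fun h' => hg (Subtype.ext h')), mul_zero, zero_mul]
  simp only [L, R]
  rw [finsum_nbr he (fun f => W x r c f b e (u - v) * W x r c d f e (u + v) *
      K x r c₀ f e e u * K x r c₀ d e e v) (fun f hf => by
        rw [K_none x r c₀ u hf, mul_zero, zero_mul]),
    finsum_nbr he (fun f => W x r c d f e (u - v) * W x r c f b e (u + v) *
      K x r c₀ f e e u * K x r c₀ b e e v) (fun f hf => by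
        rw [K_none x r c₀ u hf, mul_zero, zero_mul])]
  rcases hbi : idx (b - e) with _ | β
  · simp only [W_zero3 x r _ hbi, zero_mul, mul_zero]
  rcases hdi : idx (d - e) with _ | δ
  · simp only [W_zero1 x r _ hdi, zero_mul, mul_zero]
  rcases hci : idx (c - b) with _ | γ
  · simp only [W_zero4 x r _ hci, zero_mul, mul_zero]
  rw [idx_eq_some, sub_eq_iff_eq_add'] at hbi hdi hci
  rw [hbi] at hci
  subst hbi hdi
  have hci' : c = e + epsbar γ + epsbar β := by rw [hci]; abel
  by_cases hδ : δ ≠ β ∧ δ ≠ γ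
  · have hz : idx (c - (e + epsbar δ)) = none := by rw [hci]; exact idx_third hδ.1 hδ.2 e
    simp only [W_zero2 x r _ hz, zero_mul, mul_zero]
  have hthird : ∀ f, f ≠ β → f ≠ γ → idx (c - (e + epsbar f)) = none := by
    intro f h1 h2
    rw [hci]; exact idx_third h1 h2 e
  have hK := fun μ => hdenK e (Or.inl rfl) μ
  have hW := hdenW e (Or.inl rfl)
  by_cases hβγ : β = γ
  · subst hβγ
    have hδ' : δ = β := by tauto
    subst hδ'
    refine Finset.sum_congr rfl fun f _ => ?_
    by_cases hf : f = δ
    · subst hf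
      simp only [W_val x r e c f f f f _ hci hci]
    · simp only [W_zero2 x r _ (hthird f hf hf), zero_mul, mul_zero]
  · have two : ∀ F : Fin 3 → ℝ, (∀ f, f ≠ β → f ≠ γ → F f = 0) → ∑ f, F f = F β + F γ := by
      intro F hF
      exact Finset.sum_eq_add β γ hβγ (fun f _ hf => hF f hf.1 hf.2) (by simp) (by simp)
    rw [two _ (fun f h1 h2 => by simp only [W_zero2 x r _ (hthird f h1 h2), zero_mul]),
      two _ (fun f h1 h2 => by simp only [W_zero4 x r _ (hthird f h1 h2), zero_mul, mul_zero])]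
    have hγβ : γ ≠ β := fun h => hβγ h.symm
    have w1 : ∀ t, W x r c (e + epsbar β) (e + epsbar β) e t =
        r1 x r t * (bra x r (t - htd e γ β) * bra x r 1) /
          (bra x r (t - 1) * bra x r (htd e γ β)) := fun t => by
      rw [W_val x r e c β γ β γ t hci hci]
      simp [hβγ, hγβ]
    have w2 : ∀ t, W x r c (e + epsbar γ) (e + epsbar γ) e t =
        r1 x r t * (bra x r (t - htd e β γ) * bra x r 1) /
          (bra x r (t - 1) * bra x r (htd e β γ)) := fun t => by
      rw [W_val x r e c γ β γ β t hci' hci']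
      simp [hβγ, hγβ]
    have w3 : ∀ t, W x r c (e + epsbar β) (e + epsbar γ) e t =
        r1 x r t * (bra x r t * bra x r (htd e β γ - 1)) /
          (bra x r (t - 1) * bra x r (htd e β γ)) := fun t => by
      rw [W_val x r e c β γ γ β t hci hci']
      simp [hβγ, hγβ]
    have w4 : ∀ t, W x r c (e + epsbar γ) (e + epsbar β) e t =
        r1 x r t * (bra x r t * bra x r (htd e γ β - 1)) /
          (bra x r (t - 1) * bra x r (htd e γ β)) := fun t => by
      rw [W_val x r e c γ β β γ t hci' hci]
      simp [hβγ, hγβ]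
    by_cases hδβ : δ = β
    · subst hδβ
      simp only [w1, w2, w3, w4]
      ring
    · have hδγ : δ = γ := by tauto
      subst hδγ
      have en : htd e δ β = -htd e β δ := by unfold htd; ring
      have em : htd e 0 δ + c₀ = htd e 0 β + c₀ + htd e β δ := by unfold htd; ring
      simp only [w1, w2, w3, w4, K_val, en, em]
      have hKδ := hK δ
      rw [em] at hKδ
      exact offdiag hx0 hx1 hrpos c₀ u v (htd e 0 β + c₀) (htd e β δ) _ _ (hW β δ hβγ)
        hden₁ hden₂ hdenKu hdenKv (hK β).1 (hK β).2 hKδ.1 hKδ.2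

end ABF
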